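/- Let A = A^D be the planar forest algebra with the two bilinear operations a·b (concatenation) and a ↗ b (left grafting on the leftmost leaf), and let (C_*, d) be the associated complex. For n ≥ 1 and 1 ≤ k ≤ n, let C_n^k denote the k-th summand A^{⊗n} of C_n (elements with the first k−1 tensor signs marked) and C_n^{≤k} = ⊕_{i=1}^{k} C_n^i. Then for every n ≥ 2 and every 1 ≤ k ≤ n−1, one has Ker(d) ∩ C_n^{≤k} ⊆ d(C_{n+1}). -/

import Mathlib

noncomputable section

/-- A planar rooted tree decorated by `D`: a root decorated by an element of `D` together
with a (possibly empty) ordered list of planar subtrees. -/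
inductive PTree (D : Type) : Type
  | node : D → List (PTree D) → PTree D

/-- A nonempty planar forest decorated by `D`: a nonempty ordered list of `D`-decorated
planar rooted trees, given by its first tree and the list of the remaining ones. -/
structure PForest (D : Type) : Type where
  head : PTree D
  tail : List (PTree D)

namespace PForest

variable {D : Type}

/-- The underlying list of trees of a forest. -/
def toList (F : PForest D) : List (PTree D) := F.head :: F.tail

/-- Concatenation `F · G` of two forests. -/
def concat (F G : PForest D) : PForest D := ⟨F.head, F.tail ++ G.toList⟩

/-- Left grafting on the root: for `G = B_d(t₁ … t_m) G'`,
`F ↘ G = B_d(F t₁ … t_m) G'`. -/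
def graftRoot (F G : PForest D) : PForest D :=
  match G with
  | ⟨.node d ts, G'⟩ => ⟨.node d (F.toList ++ ts), G'⟩

/-- Left grafting of a forest on the leftmost leaf of a tree. -/
def graftLeafT (L : List (PTree D)) : PTree D → PTree D
  | .node d [] => .node d L
  | .node d (h :: hs) => .node d (graftLeafT L h :: hs)

/-- Left grafting on the leftmost leaf: for `G = B_d(H) G'`, `F ↗ G = B_d(F) G'` if `H`
is empty, and `F ↗ G = B_d(F ↗ H) G'` otherwise. -/
def graftLeaf (F G : PForest D) : PForest D := ⟨graftLeafT F.toList G.head, G.tail⟩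

/-- The single-vertex tree `•_d`, as a forest. -/
def vertex (d : D) : PForest D := ⟨.node d [], []⟩

end PForest

variable (K : Type*) [Field K] (D : Type)

/-- The planar forest algebra `A^D`: the vector space with basis the set of nonempty
`D`-decorated planar forests. -/
abbrev FA : Type _ := PForest D →₀ K

/-- The bilinear extension to `A^D` of a binary operation on forests. -/
def bil (op : PForest D → PForest D → PForest D) : FA K D →ₗ[K] FA K D →ₗ[K] FA K D :=
  Finsupp.lsum K fun F =>
    LinearMap.toSpanSingleton K (FA K D →ₗ[K] FA K D)
      (Finsupp.lsum K fun G =>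
        LinearMap.toSpanSingleton K (FA K D) (Finsupp.single (op F G) (1 : K)))
/-- Merge the entries in (0-indexed) positions `p` and `p+1` of a list by means of the
binary operation `op` (leaving the list unchanged if `p+1` is out of range). -/
def mergeAt {α : Type*} (op : α → α → α) : ℕ → List α → List α
  | 0, x :: y :: rest => op x y :: rest
  | n + 1, x :: rest => x :: mergeAt op n rest
  | _, l => l

/-- The underlying space of the complex `C_*` associated with the planar forest algebra:
basis the pointed words `(l, j)`, `l` a word of forests and `j` the (0-indexed) position
of the pointed letter (so that the `k`-th summand of `C_n = ⊕_{k=1}^n A^{⊗n}`,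
`1 ≤ k ≤ n`, consists of the pairs `(l, j)` with `l.length = n` and `j = k - 1`). -/
abbrev CC : Type _ := (List (PForest D) × ℕ) →₀ K

/-- The differential of the complex `C_*` computing the homology of the `P_↘`-algebra
`A^D`: on a pointed word, the alternating sum of the merges of adjacent letters, the
pointed letter being merged with its left neighbour by `↘` and all other pairs by the
concatenation product, the point staying on the merged letter. -/
def dCdown : CC K D →ₗ[K] CC K D :=
  Finsupp.lsum K fun q =>
    LinearMap.toSpanSingleton K (CC K D)
      (∑ p ∈ Finset.range (q.1.length - 1),
        ((-1 : K) ^ p) •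
          Finsupp.single
            (mergeAt (if p + 1 = q.2 then PForest.graftRoot else PForest.concat) p q.1,
              if p < q.2 then q.2 - 1 else q.2)
            (1 : K))

/-- The differential of the complex `C_*` computing the homology of the `P_↗`-algebra
`A^D`: on a word whose first `j` tensor signs are marked, the alternating sum of the
merges of adjacent letters, the pairs joined by a marked sign being merged by `↗` and all
other pairs by the concatenation product, the number of marked signs decreasing by one in
the first case. -/
def dCup : CC K D →ₗ[K] CC K D :=
  Finsupp.lsum K fun q =>
    LinearMap.toSpanSingleton K (CC K D)
      (∑ p ∈ Finset.range (q.1.length - 1),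
        ((-1 : K) ^ p) •
          Finsupp.single
            (mergeAt (if p < q.2 then PForest.graftLeaf else PForest.concat) p q.1,
              if p < q.2 then q.2 - 1 else q.2)
            (1 : K))
theorem mergeAt_append {α : Type*} (op : α → α → α) :
    ∀ (p : ℕ) (l r : List α), p + 1 < l.length → mergeAt op p (l ++ r) = mergeAt op p l ++ r
  | 0, _ :: _ :: _, _, _ => rfl
  | p + 1, x :: l, r, h => by
    simpa [mergeAt] using mergeAt_append op p l r (by simpa using h)

theorem mergeAt_length_append {α : Type*} (op : α → α → α) (x y : α) (r : List α) :
    ∀ l : List α, mergeAt op l.length (l ++ x :: y :: r) = l ++ op x y :: r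
  | [] => rfl
  | z :: l => by simpa [mergeAt] using mergeAt_length_append op x y r l

theorem length_mergeAt {α : Type*} (op : α → α → α) :
    ∀ (p : ℕ) (l : List α), p + 1 < l.length → (mergeAt op p l).length = l.length - 1
  | 0, _ :: _ :: _, _ => rfl
  | p + 1, x :: l, h => by
    have h' : p + 1 < l.length := by simpa using h
    simp only [mergeAt, List.length_cons, length_mergeAt op p l h']
    omega

theorem dCup_single (q : List (PForest D) × ℕ) :
    dCup K D (Finsupp.single q 1) =
      ∑ p ∈ Finset.range (q.1.length - 1),
        ((-1 : K) ^ p) •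
          Finsupp.single
            (mergeAt (if p < q.2 then PForest.graftLeaf else PForest.concat) p q.1,
              if p < q.2 then q.2 - 1 else q.2)
            (1 : K) := by
  simp [dCup]

/-- The value on a word of the contracting homotopy: it splits off the last tree of the last
letter, and vanishes when this letter is a single tree. -/
def splitLastWord (q : List (PForest D) × ℕ) : CC K D :=
  match q.1.reverse with
  | [] => 0
  | F :: r =>
    match F.tail.reverse with
    | [] => 0
    | t :: s =>
      ((-1 : K) ^ r.length) •
        Finsupp.single (r.reverse ++ [⟨F.head, s.reverse⟩, ⟨t, []⟩], q.2) (1 : K)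

/-- The linear extension of `splitLastWord`. -/
def splitLast : CC K D →ₗ[K] CC K D :=
  Finsupp.lsum K fun q => LinearMap.toSpanSingleton K (CC K D) (splitLastWord K D q)

theorem splitLast_single (q : List (PForest D) × ℕ) :
    splitLast K D (Finsupp.single q 1) = splitLastWord K D q := by
  simp [splitLast]

theorem splitLastWord_tree (w : List (PForest D)) (a : PTree D) (j : ℕ) :
    splitLastWord K D (w ++ [⟨a, []⟩], j) = 0 := by
  simp [splitLastWord]

theorem splitLastWord_append (w : List (PForest D)) (a t : PTree D) (s : List (PTree D))
    (j : ℕ) :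
    splitLastWord K D (w ++ [⟨a, s ++ [t]⟩], j) =
      ((-1 : K) ^ w.length) • Finsupp.single (w ++ [⟨a, s⟩, ⟨t, []⟩], j) (1 : K) := by
  simp [splitLastWord]

theorem splitLastWord_mem_supported (q : List (PForest D) × ℕ) :
    splitLastWord K D q ∈
      Finsupp.supported K K {q' | q'.1.length = q.1.length + 1 ∧ q'.2 = q.2} := by
  obtain ⟨l, j⟩ := q
  rcases List.eq_nil_or_concat' l with rfl | ⟨w, ⟨a, f⟩, rfl⟩
  · simp [splitLastWord]
  rcases List.eq_nil_or_concat' f with rfl | ⟨s, t, rfl⟩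
  · simp [splitLastWord_tree]
  · rw [splitLastWord_append]
    exact Submodule.smul_mem _ _ (Finsupp.single_mem_supported K _ (by simp))

/-- The part of the differential of a word, followed by the letters `r`, that comes from the
merges inside the word. -/
def dCupInner (w r : List (PForest D)) (j : ℕ) : CC K D :=
  ∑ p ∈ Finset.range (w.length - 1),
    ((-1 : K) ^ p) •
      Finsupp.single
        (mergeAt (if p < j then PForest.graftLeaf else PForest.concat) p w ++ r,
          if p < j then j - 1 else j)
        (1 : K)

theorem dCup_single_append_pair (u : List (PForest D)) (V F : PForest D) {j : ℕ}
    (hj : j ≤ u.length) :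
    dCup K D (Finsupp.single (u ++ [V, F], j) 1) =
      dCupInner K D (u ++ [V]) [F] j +
        ((-1 : K) ^ u.length) • Finsupp.single (u ++ [V.concat F], j) (1 : K) := by
  rw [dCup_single, dCupInner]
  simp only [List.length_append, List.length_cons, List.length_nil]
  rw [show u.length + (0 + 1 + 1) - 1 = u.length + 1 by omega, Finset.sum_range_succ]
  congr 1
  · refine Finset.sum_congr (by simp) fun p hp => ?_
    rw [show u ++ [V, F] = (u ++ [V]) ++ [F] by simp,
      mergeAt_append _ _ _ _ (by simpa using hp)]
  · simp [hj.not_gt, mergeAt_length_append]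

theorem dCupInner_append_pair (u r : List (PForest D)) (V F : PForest D) {j : ℕ}
    (hj : j ≤ u.length) :
    dCupInner K D (u ++ [V, F]) r j =
      dCupInner K D (u ++ [V]) (F :: r) j +
        ((-1 : K) ^ u.length) • Finsupp.single (u ++ V.concat F :: r, j) (1 : K) := by
  rw [dCupInner, dCupInner]
  simp only [List.length_append, List.length_cons, List.length_nil]
  rw [show u.length + (0 + 1 + 1) - 1 = u.length + 1 by omega, Finset.sum_range_succ]
  congr 1
  · refine Finset.sum_congr (by simp) fun p hp => ?_
    rw [show u ++ [V, F] = (u ++ [V]) ++ [F] by simp,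
      mergeAt_append _ _ _ _ (by simpa using hp)]
    simp
  · simp [hj.not_gt, mergeAt_length_append]

theorem splitLast_dCupInner_tree (u : List (PForest D)) (V : PForest D) (a : PTree D) (j : ℕ) :
    splitLast K D (dCupInner K D (u ++ [V]) [⟨a, []⟩] j) = 0 := by
  rw [dCupInner, map_sum]
  refine Finset.sum_eq_zero fun p _ => ?_
  rw [map_smul, splitLast_single, splitLastWord_tree, smul_zero]

theorem splitLast_dCupInner_append (u : List (PForest D)) (V : PForest D) (a t : PTree D)
    (s : List (PTree D)) (j : ℕ) :
    splitLast K D (dCupInner K D (u ++ [V]) [⟨a, s ++ [t]⟩] j) =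
      ((-1 : K) ^ u.length) • dCupInner K D (u ++ [V]) [⟨a, s⟩, ⟨t, []⟩] j := by
  rw [dCupInner, dCupInner, map_sum, Finset.smul_sum]
  refine Finset.sum_congr rfl fun p hp => ?_
  rw [map_smul, splitLast_single, splitLastWord_append, length_mergeAt, smul_comm]
  · simp
  · simpa using hp

theorem dCup_splitLast_add_splitLast_dCup (u : List (PForest D)) (V F : PForest D) {j : ℕ}
    (hj : j ≤ u.length) :
    dCup K D (splitLast K D (Finsupp.single (u ++ [V, F], j) 1)) +
        splitLast K D (dCup K D (Finsupp.single (u ++ [V, F], j) 1)) =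
      Finsupp.single (u ++ [V, F], j) 1 := by
  obtain ⟨b, v⟩ := V
  obtain ⟨a, f⟩ := F
  have hsq : ((-1 : K) ^ u.length) * ((-1 : K) ^ u.length) = 1 := by
    simp [← mul_pow]
  have hw (G : PForest D) : u ++ [⟨b, v⟩, G] = (u ++ [⟨b, v⟩]) ++ [G] := by simp
  rw [dCup_single_append_pair K D u _ _ hj, map_add, map_smul, splitLast_single,
    splitLast_single]
  rcases List.eq_nil_or_concat' f with rfl | ⟨s, t, rfl⟩
  · rw [hw, splitLastWord_tree, splitLast_dCupInner_tree,
      show PForest.concat ⟨b, v⟩ ⟨a, []⟩ = ⟨b, v ++ [a]⟩ from rfl, splitLastWord_append, smul_smul,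
      hsq]
    simp
  · have hc : PForest.concat ⟨b, v⟩ ⟨a, s ++ [t]⟩ = ⟨b, (v ++ a :: s) ++ [t]⟩ := by
      simp [PForest.concat, PForest.toList]
    have hs : PForest.concat ⟨b, v⟩ ⟨a, s⟩ = ⟨b, v ++ a :: s⟩ := rfl
    have ht : PForest.concat ⟨a, s⟩ ⟨t, []⟩ = ⟨a, s ++ [t]⟩ := rfl
    rw [hw, splitLastWord_append, splitLast_dCupInner_append, hc, splitLastWord_append,
      map_smul, dCup_single_append_pair K D _ _ _ (by simp; omega), ht, ← hw,
      dCupInner_append_pair K D u _ _ _ hj, hs]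
    simp only [List.length_append, List.length_cons, List.length_nil, pow_add, zero_add, pow_one,
      smul_add, smul_smul]
    simp [hsq]
    abel

/-- Let `A = A^D` be the planar forest algebra with concatenation and
left grafting `↗` on the leftmost leaf, and `(C_*, d)` the associated complex.  For
`n ≥ 2` and `1 ≤ k ≤ n - 1`, every element of `C_n^{≤ k}` (combination of words of length
`n` with fewer than `k` marked tensor signs) killed by `d` lies in `d(C_{n+1})`. -/
theorem ker_inter_le_k_sub_image_up [Fintype D] :
    ∀ n : ℕ, 2 ≤ n → ∀ k : ℕ, 1 ≤ k → k ≤ n - 1 →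
      LinearMap.ker (dCup K D) ⊓
          Finsupp.supported K K
            {q : List (PForest D) × ℕ | q.1.length = n ∧ q.2 < k} ≤
        Submodule.map (dCup K D)
          (Finsupp.supported K K
            {q : List (PForest D) × ℕ | q.1.length = n + 1 ∧ q.2 < n + 1}) := by
  rintro n hn k hk hkn x ⟨hx, hxs⟩
  refine ⟨splitLast K D x, ?_, ?_⟩
  · rw [splitLast, Finsupp.lsum_apply]
    refine Submodule.sum_mem _ fun q hq => Submodule.smul_mem _ _ ?_
    refine Finsupp.supported_mono ?_ (splitLastWord_mem_supported K D q)
    have hq' := hxs hq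
    rintro q' ⟨h₁, h₂⟩
    simp only [Set.mem_ofPred_eq] at hq' ⊢
    omega
  · have key : dCup K D (splitLast K D x) + splitLast K D (dCup K D x) = x := by
      rw [SetLike.mem_coe, Finsupp.supported_eq_span_single] at hxs
      refine LinearMap.eqOn_span (f := dCup K D ∘ₗ splitLast K D + splitLast K D ∘ₗ dCup K D)
        (g := LinearMap.id) ?_ hxs
      rintro _ ⟨⟨l, j⟩, ⟨hl, hj⟩, rfl⟩
      dsimp only at hl hj
      rcases List.eq_nil_or_concat' l with rfl | ⟨w, F, rfl⟩
      · simp at hl; omega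
      rcases List.eq_nil_or_concat' w with rfl | ⟨u, V, rfl⟩
      · simp at hl; omega
      have hju : j ≤ u.length := by simp at hl; omega
      simpa using dCup_splitLast_add_splitLast_dCup K D u V F hju
    rwa [LinearMap.mem_ker.mp hx, map_zero, add_zero] at key
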